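/- Let E = EuclideanSpace ℝ (Fin n) and M ⊆ E a compact convex set with 0 in the interior of M. Then for every x ∈ E, sSup {⟪x, y⟫ | y ∈ −M ∩ M} = sSup {⟪x, y⟫ | y ∈ E, max (sSup {⟪w, y⟫ | w ∈ M°}) (sSup {⟪w, −y⟫ | w ∈ M°}) ≤ 1}, i.e. the support function of −M ∩ M is the support function of the unit ball of the symmetrized support function of the one-sided polar M°. -/

import Mathlib

open RealInnerProductSpace

/-- The one-sided polar of a set in a real inner product space. -/
def onePolar {E : Type*} [NormedAddCommGroup E] [InnerProductSpace ℝ E] (M : Set E) : Set E :=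
  {x : E | ∀ y ∈ M, ⟪x, y⟫ ≤ 1}

/-- The bipolar theorem for the one-sided polar of a closed convex set containing the origin. -/
theorem onePolar_onePolar_eq_self {E : Type*} [NormedAddCommGroup E] [InnerProductSpace ℝ E]
    [CompleteSpace E] {M : Set E} (hcl : IsClosed M) (hconv : Convex ℝ M) (h0 : (0 : E) ∈ M) :
    onePolar (onePolar M) = M := by
  refine Set.Subset.antisymm (fun y hy => ?_) fun y hy w hw => by
    simpa only [real_inner_comm] using hw y hy
  by_contra hyM
  obtain ⟨f, u, hfM, hfy⟩ := geometric_hahn_banach_closed_point hconv hcl hyM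
  have hu : 0 < u := by simpa using hfM 0 h0
  have hinner (z : E) : ⟪u⁻¹ • (InnerProductSpace.toDual ℝ E).symm f, z⟫ = f z / u := by
    rw [real_inner_smul_left, InnerProductSpace.toDual_symm_apply, inv_mul_eq_div]
  have hw : u⁻¹ • (InnerProductSpace.toDual ℝ E).symm f ∈ onePolar M := fun z hz => by
    rw [hinner, div_le_one hu]
    exact (hfM z hz).le
  have hle := hy _ hw
  rw [real_inner_comm, hinner, div_le_one hu] at hle
  exact hle.not_gt hfy

theorem bddAbove_inner_onePolar {E : Type*} [NormedAddCommGroup E] [InnerProductSpace ℝ E]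
    {M : Set E} (h0 : (0 : E) ∈ interior M) (y : E) :
    BddAbove {s : ℝ | ∃ w ∈ onePolar M, ⟪w, y⟫ = s} := by
  have hcont : Filter.Tendsto (fun t : ℝ => t • y) (nhdsWithin 0 (Set.Ioi 0)) (nhds 0) := by
    have h : Continuous fun t : ℝ => t • y := by fun_prop
    simpa using (h.tendsto 0).mono_left nhdsWithin_le_nhds
  obtain ⟨t, htM, ht⟩ :=
    ((hcont.eventually_mem (mem_interior_iff_mem_nhds.mp h0)).and self_mem_nhdsWithin).exists
  refine ⟨1 / t, ?_⟩
  rintro _ ⟨w, hw, rfl⟩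
  have hle := hw _ htM
  rw [real_inner_smul_right] at hle
  rwa [le_div_iff₀' ht]

theorem sSup_inner_onePolar_le_one_iff {E : Type*} [NormedAddCommGroup E]
    [InnerProductSpace ℝ E] [CompleteSpace E] {M : Set E} (hcl : IsClosed M)
    (hconv : Convex ℝ M) (h0 : (0 : E) ∈ interior M) (y : E) :
    sSup {s : ℝ | ∃ w ∈ onePolar M, ⟪w, y⟫ = s} ≤ 1 ↔ y ∈ M := by
  rw [csSup_le_iff (bddAbove_inner_onePolar h0 y) ⟨0, 0, fun z _ => by simp, by simp⟩]
  conv_rhs => rw [← onePolar_onePolar_eq_self hcl hconv (interior_subset h0)]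
  constructor
  · intro h w hw
    rw [real_inner_comm]
    exact h _ ⟨w, hw, rfl⟩
  · rintro h _ ⟨w, hw, rfl⟩
    rw [real_inner_comm]
    exact h w hw

theorem support_inter_eq_support_symmetrized_ball (n : ℕ) (M : Set (EuclideanSpace ℝ (Fin n)))
    (hMc : IsCompact M) (hMconv : Convex ℝ M)
    (h0 : (0 : EuclideanSpace ℝ (Fin n)) ∈ interior M) (x : EuclideanSpace ℝ (Fin n)) :
    sSup {r : ℝ | ∃ y ∈ (-M ∩ M), ⟪x, y⟫ = r} =
      sSup {r : ℝ | ∃ y : EuclideanSpace ℝ (Fin n),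
        max (sSup {s : ℝ | ∃ w ∈ onePolar M, ⟪w, y⟫ = s})
            (sSup {s : ℝ | ∃ w ∈ onePolar M, ⟪w, -y⟫ = s}) ≤ 1 ∧ ⟪x, y⟫ = r} := by
  simp only [max_le_iff, sSup_inner_onePolar_le_one_iff hMc.isClosed hMconv h0]
  rw [Set.inter_comm]
  rfl
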